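/- Let f : F_2 × F_2 → {±1} be defined by f(x,y) = (−1)^{x+y+1}, let H be a finite simple graph of odd girth k, let α ∈ (1/2, 1), and let 0 < ε < 1 − α. Then t_H(α + εf) + t_H(1 − α − εf) ≤ α^{e(H)} + (1 − α)^{e(H)} + ε^k (−α^{e(H)−k} + (1 − α)^{e(H)−k}) + 2^{e(H)+1} ε^{k+1}. -/

import Mathlib

open Finset SimpleGraph

noncomputable section

/-- `f(x,y) = (-1)^(x+y+1)`, identifying elements of `F₂` with `0` and `1`. -/
def fWitness : ZMod 2 → ZMod 2 → ℝ := fun x y => (-1) ^ (x.val + y.val + 1)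

/-- The ordered-pair representatives `(v, w)` with `v < w` of the edges in `S`. -/
def edgePairs {V : Type} [Fintype V] [LinearOrder V] (S : Finset (Sym2 V)) :
    Finset (V × V) :=
  Finset.univ.filter fun p : V × V => p.1 < p.2 ∧ s(p.1, p.2) ∈ S

/-- `E_{x ∈ F₂^V} ∏_{vw ∈ S} g (x v) (x w)`, the expectation taken with respect to the
uniform measure on `F₂^V`. -/
def edgeExpect {V : Type} [Fintype V] [LinearOrder V] (S : Finset (Sym2 V))
    (g : ZMod 2 → ZMod 2 → ℝ) : ℝ :=
  (∑ x : V → ZMod 2, ∏ p ∈ edgePairs S, g (x p.1) (x p.2)) / 2 ^ Fintype.card V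

/-- The homomorphism density `t_H(g)` of `H` in `g : F₂ × F₂ → ℝ`. -/
def homDensity {V : Type} [Fintype V] [LinearOrder V] (H : SimpleGraph V)
    [DecidableRel H.Adj] (g : ZMod 2 → ZMod 2 → ℝ) : ℝ :=
  edgeExpect H.edgeFinset g

/-- `S` is exactly the edge set of a cycle of length `k` in `H`. -/
def IsCycleEdgeSet {V : Type} [DecidableEq V] (H : SimpleGraph V) (k : ℕ) (S : Finset (Sym2 V)) : Prop :=
  ∃ (u : V) (w : H.Walk u u), w.IsCycle ∧ w.length = k ∧ S = w.edges.toFinset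

/-- The number of edge sets `S ⊆ E(H)` forming a cycle of length `k` in `H`. -/
def cycleCount {V : Type} [DecidableEq V] (H : SimpleGraph V) (k : ℕ) : ℕ :=
  Nat.card {S : Finset (Sym2 V) // IsCycleEdgeSet H k S}

/-- `H` is isomorphic to a cycle graph. -/
def IsCycleGraph {V : Type} (H : SimpleGraph V) : Prop :=
  ∃ n : ℕ, Nonempty (H ≃g cycleGraph n)

end


theorem fW_comm (a b : ZMod 2) : fWitness a b = fWitness b a := by
  simp only [fWitness, add_comm a.val]

/-- The witness as a function of unordered pairs. -/
noncomputable def fS {V : Type} (x : V → ZMod 2) : Sym2 V → ℝ :=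
  Sym2.lift ⟨fun v w => fWitness (x v) (x w), fun _ _ => fW_comm _ _⟩

/-- The Fourier-type coefficient of an edge set. -/
noncomputable def mS {V : Type} [Fintype V] [DecidableEq V] (S : Finset (Sym2 V)) : ℝ :=
  (∑ x : V → ZMod 2, ∏ e ∈ S, fS x e) / 2 ^ Fintype.card V

theorem fW_flip_left (a b : ZMod 2) : fWitness (a + 1) b = - fWitness a b := by
  have h : (a + 1).val = a.val + 1 ∨ ((a+1).val + 1 = a.val) := by
    revert a; decide
  unfold fWitness
  rcases h with h | h
  · rw [h]; ring
  · rw [← h]; ring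

theorem fW_flip_right (a b : ZMod 2) : fWitness a (b + 1) = - fWitness a b := by
  rw [fW_comm, fW_flip_left, fW_comm]

theorem abs_fS {V : Type} (x : V → ZMod 2) (e : Sym2 V) : |fS x e| = 1 := by
  induction e with
  | h u v => simp [fS, fWitness]

theorem abs_mS {V : Type} [Fintype V] [DecidableEq V] (S : Finset (Sym2 V)) : |mS S| ≤ 1 := by
  unfold mS
  rw [abs_div, div_le_one (by positivity)]
  refine (Finset.abs_sum_le_sum_abs _ _).trans ?_
  simp [Finset.abs_prod, abs_fS]

theorem mS_bridge {V : Type} [Fintype V] [DecidableEq V] (S : Finset (Sym2 V)) (u v : V)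
    (huv : s(u, v) ∈ S) (hb : (fromEdgeSet (S : Set (Sym2 V))).IsBridge s(u, v)) : mS S = 0 := by
  classical
  rw [isBridge_iff] at hb
  set G := (fromEdgeSet (S : Set (Sym2 V))).deleteEdges {s(u, v)} with hG
  let c : V → ZMod 2 := fun w => if G.Reachable u w then 1 else 0
  have key : ∀ x : V → ZMod 2, ∏ e ∈ S, fS (x + c) e = - ∏ e ∈ S, fS x e := by
    intro x
    rw [← Finset.mul_prod_erase S _ huv, ← Finset.mul_prod_erase S (fS x) huv, ← neg_mul]
    congr 1
    · simp [fS, c, hb, fW_flip_left]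
    · refine Finset.prod_congr rfl fun e he => ?_
      induction e with
      | h a b =>
        rw [Finset.mem_erase] at he
        by_cases hab : a = b
        · subst hab
          by_cases h : G.Reachable u a <;> simp [fS, c, h, fW_flip_left, fW_flip_right]
        have hadj : G.Adj a b := by
          rw [hG, deleteEdges_adj, fromEdgeSet_adj]
          exact ⟨⟨he.2, hab⟩, he.1⟩
        have hiff : G.Reachable u a ↔ G.Reachable u b :=
          ⟨fun h => h.trans hadj.reachable, fun h => h.trans hadj.symm.reachable⟩
        by_cases h : G.Reachable u b <;> simp [fS, c, h, hiff, fW_flip_left, fW_flip_right]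
  have h2 : ∑ x : V → ZMod 2, ∏ e ∈ S, fS (x + c) e = ∑ x : V → ZMod 2, ∏ e ∈ S, fS x e :=
    Equiv.sum_comp (Equiv.addRight c) (fun x => ∏ e ∈ S, fS x e)
  simp only [key, Finset.sum_neg_distrib] at h2
  have h3 : ∑ x : V → ZMod 2, ∏ e ∈ S, fS x e = 0 := by linarith
  simp [mS, h3]

theorem walk_prod {V : Type} {H : SimpleGraph V} (x : V → ZMod 2) {u v : V} (w : H.Walk u v) :
    (w.edges.map (fS x)).prod = (-1) ^ (w.length + (x u).val + (x v).val) := by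
  induction w with
  | nil => simp [← two_mul]
  | @cons a b d h p ih =>
    rw [Walk.edges_cons, List.map_cons, List.prod_cons, ih, Walk.length_cons]
    simp only [fS, Sym2.lift_mk, fWitness]
    rw [← pow_add]
    rw [show (x a).val + (x b).val + 1 + (p.length + (x b).val + (x d).val)
      = (p.length + 1 + (x a).val + (x d).val) + 2 * (x b).val by ring, pow_add]
    simp

theorem mS_cycle {V : Type} [Fintype V] [DecidableEq V] {H : SimpleGraph V} {u : V}
    (w : H.Walk u u) (hw : w.IsCycle) (hodd : Odd w.length) : mS w.edges.toFinset = -1 := by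
  have h : ∀ x : V → ZMod 2, ∏ e ∈ w.edges.toFinset, fS x e = -1 := by
    intro x
    rw [List.prod_toFinset _ hw.edges_nodup, walk_prod, add_assoc, ← two_mul, pow_add,
      hodd.neg_one_pow]
    simp
  simp [mS, h, neg_div]

theorem mS_small {V : Type} [Fintype V] [DecidableEq V] (H : SimpleGraph V)
    (k : ℕ) (hgirth : H.egirth = k) (hodd : Odd k) (S : Finset (Sym2 V))
    (hS : (S : Set (Sym2 V)) ⊆ H.edgeSet) (hne : S.Nonempty) (hk : S.card ≤ k) :
    mS S = 0 ∨ (S.card = k ∧ mS S = -1) := by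
  by_cases hac : (fromEdgeSet (S : Set (Sym2 V))).IsAcyclic
  · left
    obtain ⟨e, he⟩ := hne
    induction e with
    | h u v =>
      refine mS_bridge S u v he ?_
      apply isAcyclic_iff_forall_adj_isBridge.1 hac
      rw [fromEdgeSet_adj]
      exact ⟨he, (H.mem_edgeSet.1 (hS he)).ne⟩
  · right
    have hle : fromEdgeSet (S : Set (Sym2 V)) ≤ H := by
      intro a b hab
      exact hS (fromEdgeSet_adj _ |>.1 hab).1
    unfold IsAcyclic at hac
    push Not at hac
    obtain ⟨u, w, hw⟩ := hac
    have h1 : k ≤ w.length := by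
      have := egirth_le_length (hw.mapLe hle)
      rw [hgirth] at this
      simpa using this
    have h2 : w.edges.toFinset ⊆ S := by
      intro e he
      have := w.edges_subset_edgeSet (List.mem_toFinset.1 he)
      rw [edgeSet_fromEdgeSet] at this
      exact this.1
    have h3 : w.edges.toFinset.card = w.length := by
      rw [List.toFinset_card_of_nodup hw.edges_nodup, Walk.length_edges]
    have h4 := Finset.eq_of_subset_of_card_le h2 (by omega)
    have h5 : w.length = k := by
      have := Finset.card_le_card h2
      omega
    refine ⟨by rw [← h4]; omega, ?_⟩
    rw [← h4]
    exact mS_cycle w hw (h5 ▸ hodd)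

theorem prod_edgePairs {V : Type} [Fintype V] [LinearOrder V] (H : SimpleGraph V)
    [DecidableRel H.Adj] (F : Sym2 V → ℝ) :
    ∏ p ∈ edgePairs H.edgeFinset, F s(p.1, p.2) = ∏ e ∈ H.edgeFinset, F e := by
  refine Finset.prod_bij (fun p _ => s(p.1, p.2)) ?_ ?_ ?_ ?_
  · intro p hp
    exact (Finset.mem_filter.1 hp).2.2
  · rintro ⟨a, b⟩ hp ⟨c, d⟩ hq h
    have h1 := (Finset.mem_filter.1 hp).2.1
    have h2 := (Finset.mem_filter.1 hq).2.1
    simp only [Sym2.eq_iff] at h h1 h2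
    rcases h with ⟨rfl, rfl⟩ | ⟨rfl, rfl⟩
    · rfl
    · exact absurd h1 (not_lt.2 h2.le)
  · intro e he
    induction e with
    | h a b =>
      have hab : H.Adj a b := by simpa using he
      rcases lt_or_gt_of_ne hab.ne with h | h
      · exact ⟨(a, b), Finset.mem_filter.2 ⟨Finset.mem_univ _, h, he⟩, rfl⟩
      · exact ⟨(b, a), Finset.mem_filter.2 ⟨Finset.mem_univ _, h, by rwa [Sym2.eq_swap]⟩,
          Sym2.eq_swap⟩
  · intro p _
    rfl

theorem homDensity_expand {V : Type} [Fintype V] [LinearOrder V] (H : SimpleGraph V)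
    [DecidableRel H.Adj] (a b : ℝ) :
    homDensity H (fun x y => a + b * fWitness x y) =
      ∑ S ∈ H.edgeFinset.powerset, b ^ S.card * a ^ (H.edgeFinset.card - S.card) * mS S := by
  have h1 : ∀ x : V → ZMod 2,
      ∏ p ∈ edgePairs H.edgeFinset, (a + b * fWitness (x p.1) (x p.2)) =
      ∑ S ∈ H.edgeFinset.powerset,
        b ^ S.card * a ^ (H.edgeFinset.card - S.card) * ∏ e ∈ S, fS x e := by
    intro x
    have := prod_edgePairs H (fun e => b * fS x e + a)
    simp only [fS, Sym2.lift_mk] at this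
    simp only [add_comm a]
    rw [this, Finset.prod_add]
    refine Finset.sum_congr rfl fun S hS => ?_
    rw [Finset.prod_mul_distrib, Finset.prod_const, Finset.prod_const,
      Finset.card_sdiff_of_subset (Finset.mem_powerset.1 hS)]
    simp only [fS]
    ring
  unfold homDensity edgeExpect
  simp only [h1]
  rw [Finset.sum_comm, Finset.sum_div]
  refine Finset.sum_congr rfl fun S _ => ?_
  rw [← Finset.mul_sum, mS, mul_div_assoc]

theorem mS_empty {V : Type} [Fintype V] [DecidableEq V] : mS (∅ : Finset (Sym2 V)) = 1 := by
  simp [mS]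

theorem stmt9_combined_bound {V : Type} [Fintype V] [LinearOrder V] (H : SimpleGraph V) [DecidableRel H.Adj]
    (k : ℕ) (hgirth : H.egirth = k) (hodd : Odd k)
    (α ε : ℝ) (hα : α ∈ Set.Ioo (1 / 2 : ℝ) 1) (hε : 0 < ε) (hε' : ε < 1 - α) :
    homDensity H (fun x y => α + ε * fWitness x y)
        + homDensity H (fun x y => 1 - α - ε * fWitness x y)
      ≤ α ^ H.edgeFinset.card + (1 - α) ^ H.edgeFinset.card
          + ε ^ k * (-α ^ (H.edgeFinset.card - k) + (1 - α) ^ (H.edgeFinset.card - k))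
          + 2 ^ (H.edgeFinset.card + 1) * ε ^ (k + 1) := by
  have h2 := homDensity_expand H (1 - α) (-ε)
  simp only [neg_mul, ← sub_eq_add_neg] at h2
  rw [homDensity_expand H α ε, h2, ← Finset.sum_add_distrib]
  obtain ⟨hα1, hα2⟩ := hα
  have hnac : ¬ H.IsAcyclic := by
    rw [← egirth_eq_top, hgirth]
    exact ENat.coe_ne_top k
  obtain ⟨u, w, hw, hlen⟩ := exists_egirth_eq_length.2 hnac
  have hwk : w.length = k := by
    rw [hgirth] at hlen
    exact_mod_cast hlen.symm
  have hk3 : 3 ≤ k := hwk ▸ hw.three_le_length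
  set E := H.edgeFinset with hE
  set T : Finset (Sym2 V) → ℝ := fun S =>
    ε ^ S.card * α ^ (E.card - S.card) * mS S
      + (-ε) ^ S.card * (1 - α) ^ (E.card - S.card) * mS S with hT
  set C := w.edges.toFinset with hC
  have hCc : C.card = k := by
    rw [hC, List.toFinset_card_of_nodup hw.edges_nodup, Walk.length_edges, hwk]
  have hCE : C ∈ E.powerset := by
    rw [Finset.mem_powerset]
    intro e he
    rw [hE, mem_edgeFinset]
    exact w.edges_subset_edgeSet (List.mem_toFinset.1 he)
  have hC0 : C ≠ ∅ := by
    intro h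
    rw [h] at hCc
    simp at hCc
    omega
  have hmC : mS C = -1 := mS_cycle w hw (hwk ▸ hodd)
  have hTC : T C = ε ^ k * (-α ^ (E.card - k) + (1 - α) ^ (E.card - k)) := by
    simp only [hT, hCc, hmC, hodd.neg_pow]
    ring
  have hT0 : T ∅ = α ^ E.card + (1 - α) ^ E.card := by
    simp [hT, mS_empty]
  have hbound : ∀ S ∈ (E.powerset.erase ∅).erase C, T S ≤ 2 * ε ^ (k + 1) := by
    intro S hS
    rw [Finset.mem_erase, Finset.mem_erase, Finset.mem_powerset] at hS
    obtain ⟨-, hS0, hSE⟩ := hS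
    have hpos : 0 ≤ 2 * ε ^ (k + 1) := by positivity
    by_cases hk : S.card ≤ k
    · have hsub : (S : Set (Sym2 V)) ⊆ H.edgeSet := by
        intro e he
        exact mem_edgeFinset.1 (hSE he)
      rcases mS_small H k hgirth hodd S hsub (Finset.nonempty_iff_ne_empty.2 hS0) hk with h | ⟨h, h'⟩
      · simpa [hT, h] using hpos
      · refine le_trans ?_ hpos
        have hp : (1 - α) ^ (E.card - k) ≤ α ^ (E.card - k) :=
          pow_le_pow_left₀ (by linarith) (by linarith) _
        have he : 0 < ε ^ k := by positivity
        simp only [hT, h, h', hodd.neg_pow]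
        nlinarith
    · have he : ε ^ S.card ≤ ε ^ (k + 1) :=
        pow_le_pow_of_le_one hε.le (by linarith) (by omega)
      have hgen : ∀ b a : ℝ, |b| = ε → 0 ≤ a → a ≤ 1 →
          b ^ S.card * a ^ (E.card - S.card) * mS S ≤ ε ^ (k + 1) := by
        intro b a hb ha0 ha1
        refine (le_abs_self _).trans ?_
        rw [abs_mul, abs_mul, abs_pow, hb, abs_pow, abs_of_nonneg ha0]
        have h1 : a ^ (E.card - S.card) ≤ 1 := pow_le_one₀ ha0 ha1
        have h0 : 0 ≤ a ^ (E.card - S.card) := by positivity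
        have hs : 0 ≤ ε ^ S.card := by positivity
        calc ε ^ S.card * a ^ (E.card - S.card) * |mS S|
            ≤ ε ^ S.card * 1 * 1 := by
              gcongr
              exact abs_mS S
          _ ≤ ε ^ (k + 1) := by simpa using he
      have ha := hgen ε α (abs_of_pos hε) (by linarith) (by linarith)
      have hb := hgen (-ε) (1 - α) (by rw [abs_neg, abs_of_pos hε]) (by linarith) (by linarith)
      simp only [hT]
      linarith
  have hsum := Finset.sum_le_card_nsmul _ _ _ hbound
  have hcard : (((E.powerset.erase ∅).erase C).card : ℝ) ≤ 2 ^ E.card := by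
    have : ((E.powerset.erase ∅).erase C).card ≤ E.powerset.card :=
      Finset.card_le_card ((Finset.erase_subset _ _).trans (Finset.erase_subset _ _))
    rw [Finset.card_powerset] at this
    exact_mod_cast this
  rw [nsmul_eq_mul] at hsum
  have hfin : (((E.powerset.erase ∅).erase C).card : ℝ) * (2 * ε ^ (k + 1))
      ≤ 2 ^ (E.card + 1) * ε ^ (k + 1) := by
    calc _ ≤ 2 ^ E.card * (2 * ε ^ (k + 1)) := by gcongr
      _ = _ := by ring
  rw [← Finset.add_sum_erase E.powerset T (Finset.empty_mem_powerset E),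
    ← Finset.add_sum_erase (E.powerset.erase ∅) T (Finset.mem_erase.2 ⟨hC0, hCE⟩), hT0, hTC]
  linarith
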